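/- Let A > 0 and let f : [0,A] → ℝ be locally absolutely continuous with locally absolutely continuous derivative f′ and with f″ ∈ L²([0,A]). Then for every ε > 0, with K(ε) = 1/ε + 12/A², one has ∫₀^A (f′(t))² dt ≤ K(ε) ∫₀^A (f(t))² dt + ε ∫₀^A (f″(t))² dt. -/

import Mathlib

open MeasureTheory Set

/-- A function `Ψ` on `[0, 1]` that does not decrease from `0` to `1` and whose derivative is
bounded above by `J`; its existence forces `0 ≤ ∫₀¹ J`. -/
def HasCertificate (J : ℝ → ℝ) : Prop :=
  ∃ Ψ ψ : ℝ → ℝ, (∀ t ∈ Icc (0 : ℝ) 1, HasDerivWithinAt Ψ (ψ t) (Icc (0 : ℝ) 1) t) ∧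
    (∀ t ∈ Icc (0 : ℝ) 1, ψ t ≤ J t) ∧ Ψ 0 ≤ Ψ 1

theorem HasCertificate.add {J K : ℝ → ℝ} (hJ : HasCertificate J) (hK : HasCertificate K) :
    HasCertificate (fun t => J t + K t) := by
  obtain ⟨Ψ, ψ, h1, h2, h3⟩ := hJ
  obtain ⟨Ξ, ξ, k1, k2, k3⟩ := hK
  exact ⟨fun t => Ψ t + Ξ t, fun t => ψ t + ξ t, fun t ht => (h1 t ht).add (k1 t ht),
    fun t ht => add_le_add (h2 t ht) (k2 t ht), add_le_add h3 k3⟩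

theorem HasCertificate.integral_nonneg {J : ℝ → ℝ} (hJ : HasCertificate J)
    (hint : IntervalIntegrable J volume 0 1) : 0 ≤ ∫ t in (0 : ℝ)..1, J t := by
  obtain ⟨Ψ, ψ, h1, h2, h3⟩ := hJ
  have key := intervalIntegral.sub_le_integral_of_hasDeriv_right_of_le zero_le_one
    (fun t ht => (h1 t ht).continuousWithinAt)
    (fun t ht => ((h1 t (Ioo_subset_Icc_self ht)).hasDerivAt
      (Icc_mem_nhds ht.1 ht.2)).hasDerivWithinAt)
    ((intervalIntegrable_iff_integrableOn_Icc_of_le zero_le_one).1 hint)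
    (fun t ht => h2 t (Ioo_subset_Icc_self ht))
  linarith

section Half

variable {u v w : ℝ → ℝ}

/-- A test function `φ` with the boundary behaviour of `u` at `0` provides a certificate. -/
theorem hasCertificate_of_test
    (hu : ∀ t ∈ Icc (0 : ℝ) 1, HasDerivWithinAt u (v t) (Icc (0 : ℝ) 1) t)
    (hv : ∀ t ∈ Icc (0 : ℝ) 1, HasDerivWithinAt v (w t) (Icc (0 : ℝ) 1) t)
    {z : ℝ} (hz : 0 < z) {φ φ' φ'' Θ : ℝ → ℝ}
    (hφ : ∀ t, HasDerivAt φ (φ' t) t) (hφ' : ∀ t, HasDerivAt φ' (φ'' t) t)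
    (hΘ : ∀ t, HasDerivAt Θ
      (z * (z + 4) * φ t ^ 2 + 4 / 3 * (φ'' t + z / 2 * φ t) ^ 2) t)
    (huv : u 0 * v 0 = 0) (h0 : v 0 * φ 0 - u 0 * φ' 0 = 0)
    (hpos : 0 < φ 1 * -φ' 1) (hle : Θ 1 - Θ 0 ≤ 4 * (z + 4) * (φ 1 * -φ' 1)) :
    HasCertificate (fun t => w t ^ 2 - z * v t ^ 2 + (z ^ 2 + 3 * z) * u t ^ 2) := by
  set k := φ 1 * -φ' 1 with hk
  set ℓ := v 1 * φ 1 - u 1 * φ' 1 with hℓ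
  set c := z * ℓ / (4 * k) with hc
  refine ⟨fun t => 2 * c * (v t * φ t - u t * φ' t) - z * (u t * v t)
      - c ^ 2 / (z * (z + 4)) * Θ t,
    fun t => 2 * c * ((w t * φ t + v t * φ' t) - (v t * φ' t + u t * φ'' t))
      - z * (v t * v t + u t * w t)
      - c ^ 2 / (z * (z + 4)) *
        (z * (z + 4) * φ t ^ 2 + 4 / 3 * (φ'' t + z / 2 * φ t) ^ 2), ?_, ?_, ?_⟩
  · intro t ht
    have h1 := (hφ t).hasDerivWithinAt (s := Icc (0 : ℝ) 1)
    have h2 := (hφ' t).hasDerivWithinAt (s := Icc (0 : ℝ) 1)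
    have h3 := (hΘ t).hasDerivWithinAt (s := Icc (0 : ℝ) 1)
    exact (((((hv t ht).mul h1).sub ((hu t ht).mul h2)).const_mul (2 * c)).sub
      (((hu t ht).mul (hv t ht)).const_mul z)).sub (h3.const_mul _)
  · intro t _
    have e : w t ^ 2 - z * v t ^ 2 + (z ^ 2 + 3 * z) * u t ^ 2
        - (2 * c * ((w t * φ t + v t * φ' t) - (v t * φ' t + u t * φ'' t))
          - z * (v t * v t + u t * w t)
          - c ^ 2 / (z * (z + 4)) *
            (z * (z + 4) * φ t ^ 2 + 4 / 3 * (φ'' t + z / 2 * φ t) ^ 2))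
        = (w t + z / 2 * u t - c * φ t) ^ 2
          + 3 / 4 * (z * (z + 4)) *
            (u t + 4 / 3 / (z * (z + 4)) * c * (φ'' t + z / 2 * φ t)) ^ 2 := by
      field_simp
      ring
    have : 0 ≤ (w t + z / 2 * u t - c * φ t) ^ 2
          + 3 / 4 * (z * (z + 4)) *
            (u t + 4 / 3 / (z * (z + 4)) * c * (φ'' t + z / 2 * φ t)) ^ 2 := by positivity
    linarith
  · have e1 : c ^ 2 / (z * (z + 4)) * (Θ 1 - Θ 0) ≤ c ^ 2 / (z * (z + 4)) * (4 * (z + 4) * k) :=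
      mul_le_mul_of_nonneg_left hle (by positivity)
    have e2 : 2 * c * ℓ - z * (u 1 * v 1) - c ^ 2 / (z * (z + 4)) * (4 * (z + 4) * k)
        = z / (4 * k) * (v 1 * φ 1 + u 1 * φ' 1) ^ 2 := by
      rw [hc]
      field_simp
      rw [hℓ, hk]
      ring
    have e3 : 0 ≤ z / (4 * k) * (v 1 * φ 1 + u 1 * φ' 1) ^ 2 := by positivity
    simp only [h0, huv]
    linarith

theorem hasDerivAt_integral_sq_even (b c d t : ℝ) :
    HasDerivAt (fun t : ℝ => b ^ 2 * t + 2 * b * c / 3 * t ^ 3 + (c ^ 2 + 2 * b * d) / 5 * t ^ 5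
      + 2 * c * d / 7 * t ^ 7 + d ^ 2 / 9 * t ^ 9) ((b + c * t ^ 2 + d * t ^ 4) ^ 2) t := by
  have h := (((((hasDerivAt_id t).const_mul (b ^ 2)).add
    ((hasDerivAt_pow 3 t).const_mul (2 * b * c / 3))).add
    ((hasDerivAt_pow 5 t).const_mul ((c ^ 2 + 2 * b * d) / 5))).add
    ((hasDerivAt_pow 7 t).const_mul (2 * c * d / 7))).add
    ((hasDerivAt_pow 9 t).const_mul (d ^ 2 / 9))
  exact h.congr_deriv (by push_cast; ring)

theorem hasDerivAt_integral_sq_odd (b c d t : ℝ) :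
    HasDerivAt (fun t : ℝ => b ^ 2 / 3 * t ^ 3 + 2 * b * c / 5 * t ^ 5
      + (c ^ 2 + 2 * b * d) / 7 * t ^ 7 + 2 * c * d / 9 * t ^ 9 + d ^ 2 / 11 * t ^ 11)
      ((b * t + c * t ^ 3 + d * t ^ 5) ^ 2) t := by
  have h := (((((hasDerivAt_pow 3 t).const_mul (b ^ 2 / 3)).add
    ((hasDerivAt_pow 5 t).const_mul (2 * b * c / 5))).add
    ((hasDerivAt_pow 7 t).const_mul ((c ^ 2 + 2 * b * d) / 7))).add
    ((hasDerivAt_pow 9 t).const_mul (2 * c * d / 9))).add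
    ((hasDerivAt_pow 11 t).const_mul (d ^ 2 / 11))
  exact h.congr_deriv (by push_cast; ring)

theorem hasCertificate_of_even_polynomial
    (hu : ∀ t ∈ Icc (0 : ℝ) 1, HasDerivWithinAt u (v t) (Icc (0 : ℝ) 1) t)
    (hv : ∀ t ∈ Icc (0 : ℝ) 1, HasDerivWithinAt v (w t) (Icc (0 : ℝ) 1) t)
    (hv0 : v 0 = 0) {z : ℝ} (hz : 0 < z) (b c d : ℝ)
    (hpos : 0 < (b + c + d) * -(2 * c + 4 * d))
    (hle : z * (z + 4) * (b ^ 2 + 2 * b * c / 3 + (c ^ 2 + 2 * b * d) / 5 + 2 * c * d / 7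
        + d ^ 2 / 9)
      + 4 / 3 * ((2 * c + z / 2 * b) ^ 2 + 2 * (2 * c + z / 2 * b) * (12 * d + z / 2 * c) / 3
        + ((12 * d + z / 2 * c) ^ 2 + 2 * (2 * c + z / 2 * b) * (z / 2 * d)) / 5
        + 2 * (12 * d + z / 2 * c) * (z / 2 * d) / 7 + (z / 2 * d) ^ 2 / 9)
      ≤ 4 * (z + 4) * ((b + c + d) * -(2 * c + 4 * d))) :
    HasCertificate (fun t => w t ^ 2 - z * v t ^ 2 + (z ^ 2 + 3 * z) * u t ^ 2) := by
  refine hasCertificate_of_test hu hv hz (φ := fun t => b + c * t ^ 2 + d * t ^ 4)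
    (φ' := fun t => 2 * c * t + 4 * d * t ^ 3) (φ'' := fun t => 2 * c + 12 * d * t ^ 2)
    (fun t => ?_) (fun t => ?_)
    (fun t => (((hasDerivAt_integral_sq_even b c d t).const_mul (z * (z + 4))).add
      ((hasDerivAt_integral_sq_even (2 * c + z / 2 * b) (12 * d + z / 2 * c) (z / 2 * d)
        t).const_mul (4 / 3))).congr_deriv (by ring))
    (by simp [hv0]) (by simp [hv0]) (by simpa using hpos) (by simpa using hle)
  · have h := (((hasDerivAt_pow 2 t).const_mul c).const_add b).add
      ((hasDerivAt_pow 4 t).const_mul d)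
    exact h.congr_deriv (by push_cast; ring)
  · have h := ((hasDerivAt_id t).const_mul (2 * c)).add ((hasDerivAt_pow 3 t).const_mul (4 * d))
    exact h.congr_deriv (by push_cast; ring)

theorem hasCertificate_of_odd_polynomial
    (hu : ∀ t ∈ Icc (0 : ℝ) 1, HasDerivWithinAt u (v t) (Icc (0 : ℝ) 1) t)
    (hv : ∀ t ∈ Icc (0 : ℝ) 1, HasDerivWithinAt v (w t) (Icc (0 : ℝ) 1) t)
    (hu0 : u 0 = 0) {z : ℝ} (hz : 0 < z) (b c d : ℝ)
    (hpos : 0 < (b + c + d) * -(b + 3 * c + 5 * d))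
    (hle : z * (z + 4) * (b ^ 2 / 3 + 2 * b * c / 5 + (c ^ 2 + 2 * b * d) / 7 + 2 * c * d / 9
        + d ^ 2 / 11)
      + 4 / 3 * ((6 * c + z / 2 * b) ^ 2 / 3 + 2 * (6 * c + z / 2 * b) * (20 * d + z / 2 * c) / 5
        + ((20 * d + z / 2 * c) ^ 2 + 2 * (6 * c + z / 2 * b) * (z / 2 * d)) / 7
        + 2 * (20 * d + z / 2 * c) * (z / 2 * d) / 9 + (z / 2 * d) ^ 2 / 11)
      ≤ 4 * (z + 4) * ((b + c + d) * -(b + 3 * c + 5 * d))) :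
    HasCertificate (fun t => w t ^ 2 - z * v t ^ 2 + (z ^ 2 + 3 * z) * u t ^ 2) := by
  refine hasCertificate_of_test hu hv hz (φ := fun t => b * t + c * t ^ 3 + d * t ^ 5)
    (φ' := fun t => b + 3 * c * t ^ 2 + 5 * d * t ^ 4)
    (φ'' := fun t => 6 * c * t + 20 * d * t ^ 3)
    (fun t => ?_) (fun t => ?_)
    (fun t => (((hasDerivAt_integral_sq_odd b c d t).const_mul (z * (z + 4))).add
      ((hasDerivAt_integral_sq_odd (6 * c + z / 2 * b) (20 * d + z / 2 * c) (z / 2 * d)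
        t).const_mul (4 / 3))).congr_deriv (by ring))
    (by simp [hu0]) (by simp [hu0]) (by simpa using hpos) (by simpa using hle)
  · have h := (((hasDerivAt_id t).const_mul b).add ((hasDerivAt_pow 3 t).const_mul c)).add
      ((hasDerivAt_pow 5 t).const_mul d)
    exact h.congr_deriv (by push_cast; ring)
  · have h := (((hasDerivAt_pow 2 t).const_mul (3 * c)).const_add b).add
      ((hasDerivAt_pow 4 t).const_mul (5 * d))
    exact h.congr_deriv (by push_cast; ring)

theorem hasCertificate_even_of_le
    (hu : ∀ t ∈ Icc (0 : ℝ) 1, HasDerivWithinAt u (v t) (Icc (0 : ℝ) 1) t)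
    (hv : ∀ t ∈ Icc (0 : ℝ) 1, HasDerivWithinAt v (w t) (Icc (0 : ℝ) 1) t)
    (hv0 : v 0 = 0) {z : ℝ} (hz : 0 < z) (hz' : z ≤ 21) :
    HasCertificate (fun t => w t ^ 2 - z * v t ^ 2 + (z ^ 2 + 3 * z) * u t ^ 2) := by
  rcases le_total z (557 / 100) with h1 | h1
  · exact hasCertificate_of_even_polynomial hu hv hv0 hz 10 16 (-15) (by norm_num)
      (by nlinarith)
  rcases le_total z (23 / 2) with h2 | h2
  · exact hasCertificate_of_even_polynomial hu hv hv0 hz 1 20 (-15) (by norm_num)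
      (by nlinarith)
  · exact hasCertificate_of_even_polynomial hu hv hv0 hz (-3) 28 (-20) (by norm_num)
      (by nlinarith)

theorem hasCertificate_odd_of_le
    (hu : ∀ t ∈ Icc (0 : ℝ) 1, HasDerivWithinAt u (v t) (Icc (0 : ℝ) 1) t)
    (hv : ∀ t ∈ Icc (0 : ℝ) 1, HasDerivWithinAt v (w t) (Icc (0 : ℝ) 1) t)
    (hu0 : u 0 = 0) {z : ℝ} (hz : 0 < z) (hz' : z ≤ 21) :
    HasCertificate (fun t => w t ^ 2 - z * v t ^ 2 + (z ^ 2 + 3 * z) * u t ^ 2) := by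
  rcases le_total z (11 / 2) with h1 | h1
  · exact hasCertificate_of_odd_polynomial hu hv hu0 hz 2 (-1) 0 (by norm_num)
      (by nlinarith)
  rcases le_total z (76 / 5) with h2 | h2
  · exact hasCertificate_of_odd_polynomial hu hv hu0 hz 7 8 (-10) (by norm_num)
      (by nlinarith)
  · exact hasCertificate_of_odd_polynomial hu hv hu0 hz (-2) 27 (-20) (by norm_num)
      (by nlinarith)

/-- A solution `η` of the damped oscillator equation `η'' + P η' + Q η = 0` that has nearly
died out at `1` provides a certificate. -/
theorem hasCertificate_of_oscillator
    (hu : ∀ t ∈ Icc (0 : ℝ) 1, HasDerivWithinAt u (v t) (Icc (0 : ℝ) 1) t)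
    (hv : ∀ t ∈ Icc (0 : ℝ) 1, HasDerivWithinAt v (w t) (Icc (0 : ℝ) 1) t)
    {z P Q R M : ℝ} (hP : 0 < P) (hQ : 0 < Q) (hR : 0 < R) (hM : 0 < M)
    (hPQ : P ^ 2 - 2 * Q = -z) (hPQR : Q = P ^ 2 - R) (hQz : Q ^ 2 ≤ z ^ 2 + 3 * z)
    {η η' : ℝ → ℝ} (hη : ∀ t, HasDerivAt η (η' t) t)
    (hη' : ∀ t, HasDerivAt η' (-P * η' t - Q * η t) t)
    (h0 : P * v 0 ^ 2 - 2 * Q * (u 0 * v 0) + P * Q * u 0 ^ 2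
      = M * (v 0 * η 0 - u 0 * (η' 0 + P * η 0)) ^ 2)
    (hM0 : M * (η' 0 ^ 2 / (2 * P * Q) + η 0 * η' 0 / Q + (1 / (2 * P) + P / (2 * Q)) * η 0 ^ 2)
      = 1 / 2)
    (hM1 : M * (P * η' 1 ^ 2 + 2 * R * (η 1 * η' 1) + P * R * η 1 ^ 2) ≤ Q * R / 2) :
    HasCertificate (fun t => w t ^ 2 - z * v t ^ 2 + (z ^ 2 + 3 * z) * u t ^ 2) := by
  set c := M * (v 0 * η 0 - u 0 * (η' 0 + P * η 0)) with hc
  refine ⟨fun t => P * (v t * v t) - 2 * Q * (u t * v t) + P * Q * (u t * u t)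
      - 2 * c * (v t * η t - u t * (η' t + P * η t))
      + c ^ 2 * (1 / (2 * P * Q) * (η' t * η' t) + 1 / Q * (η t * η' t)
        + (1 / (2 * P) + P / (2 * Q)) * (η t * η t)),
    fun t => 2 * P * (v t * w t) - 2 * Q * (v t * v t + u t * w t) + 2 * P * Q * (u t * v t)
      - 2 * c * ((w t - P * v t + Q * u t) * η t) - c ^ 2 * η t ^ 2,
    fun t ht => ?_, fun t _ => ?_, ?_⟩
  · have h1 := (hη t).hasDerivWithinAt (s := Icc (0 : ℝ) 1)
    have h2 := (hη' t).hasDerivWithinAt (s := Icc (0 : ℝ) 1)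
    have hu := hu t ht
    have hv := hv t ht
    refine ((((((hv.mul hv).const_mul P).sub ((hu.mul hv).const_mul (2 * Q))).add
      ((hu.mul hu).const_mul (P * Q))).sub
      (((hv.mul h1).sub (hu.mul (h2.add (h1.const_mul P)))).const_mul (2 * c))).add
      (((((h2.mul h2).const_mul (1 / (2 * P * Q))).add ((h1.mul h2).const_mul (1 / Q))).add
      ((h1.mul h1).const_mul (1 / (2 * P) + P / (2 * Q)))).const_mul (c ^ 2))).congr_deriv ?_
    simp only [Pi.add_apply]
    field_simp
    ring
  · have e : (z ^ 2 + 3 * z - Q ^ 2) * u t ^ 2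
        + (w t - P * v t + Q * u t + c * η t) ^ 2 ≥ 0 := by
      have := sub_nonneg.2 hQz
      positivity
    have hz : z = 2 * Q - P ^ 2 := by linarith
    subst hz
    refine sub_nonneg.1 (le_of_le_of_eq e ?_)
    ring
  · have e0 : P * (v 0 * v 0) - 2 * Q * (u 0 * v 0) + P * Q * (u 0 * u 0)
        - 2 * c * (v 0 * η 0 - u 0 * (η' 0 + P * η 0))
        + c ^ 2 * (1 / (2 * P * Q) * (η' 0 * η' 0) + 1 / Q * (η 0 * η' 0)
          + (1 / (2 * P) + P / (2 * Q)) * (η 0 * η 0)) = - (c ^ 2 / (2 * M)) := by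
      have e : c ^ 2 * (1 / (2 * P * Q) * (η' 0 * η' 0) + 1 / Q * (η 0 * η' 0)
          + (1 / (2 * P) + P / (2 * Q)) * (η 0 * η 0)) = c ^ 2 / (2 * M) := by
        rw [eq_div_iff (by positivity)]
        linear_combination (2 * c ^ 2) * hM0
      rw [e]
      have e' : c * (v 0 * η 0 - u 0 * (η' 0 + P * η 0)) = c ^ 2 / M := by
        rw [hc]; field_simp
      have e'' : M * (v 0 * η 0 - u 0 * (η' 0 + P * η 0)) ^ 2 = c ^ 2 / M := by
        rw [hc]; field_simp
      rw [e''] at h0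
      have e3 : c ^ 2 / (2 * M) = c ^ 2 / M / 2 := by field_simp
      rw [e3]
      linarith
    have e1 : 0 ≤ 1 / (2 * P * Q) * (η' 1 * η' 1) + 1 / Q * (η 1 * η' 1)
        + (1 / (2 * P) + P / (2 * Q)) * (η 1 * η 1) := by
      have : 1 / (2 * P * Q) * (η' 1 * η' 1) + 1 / Q * (η 1 * η' 1)
        + (1 / (2 * P) + P / (2 * Q)) * (η 1 * η 1)
        = 1 / (2 * P * Q) * (η' 1 + P * η 1) ^ 2 + 1 / (2 * P) * η 1 ^ 2 := by
        field_simp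
        ring
      rw [this]
      positivity
    have e2 : P * (v 1 * v 1) - 2 * Q * (u 1 * v 1) + P * Q * (u 1 * u 1)
        - 2 * c * (v 1 * η 1 - u 1 * (η' 1 + P * η 1))
        + c ^ 2 * ((P * η' 1 ^ 2 + 2 * R * (η 1 * η' 1) + P * R * η 1 ^ 2) / (Q * R))
        = P * (v 1 - (Q * u 1 + c * η 1) / P) ^ 2
          + Q * R / P * (u 1 + c * (P * η' 1 + R * η 1) / (Q * R)) ^ 2 := by
      have hR' : R = P ^ 2 - Q := by linarith
      field_simp
      rw [hR']
      ring
    have e3 : 0 ≤ P * (v 1 - (Q * u 1 + c * η 1) / P) ^ 2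
          + Q * R / P * (u 1 + c * (P * η' 1 + R * η 1) / (Q * R)) ^ 2 := by positivity
    have e4 : c ^ 2 * ((P * η' 1 ^ 2 + 2 * R * (η 1 * η' 1) + P * R * η 1 ^ 2) / (Q * R))
        ≤ c ^ 2 * (1 / (2 * M)) := by
      refine mul_le_mul_of_nonneg_left ?_ (by positivity)
      rw [div_le_div_iff₀ (by positivity) (by positivity)]
      linarith
    have e5 : c ^ 2 * (1 / (2 * M)) = c ^ 2 / (2 * M) := by ring
    have e6 := mul_nonneg (sq_nonneg c) e1
    simp only at e0 ⊢
    linarith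

theorem four_mul_sq_le_exp {a : ℝ} (ha : 9 / 2 ≤ a) : 4 * a ^ 2 ≤ Real.exp a := by
  have h1 : 2 * a ≤ Real.exp (a / 2) := by
    have e : Real.exp (a / 2) = Real.exp 1 ^ 2 * Real.exp (1 / 4) * Real.exp (a / 2 - 9 / 4) := by
      rw [← Real.exp_nat_mul, ← Real.exp_add, ← Real.exp_add]
      congr 1
      push_cast
      ring
    have h2 : (9 : ℝ) ≤ Real.exp 1 ^ 2 * Real.exp (1 / 4) := by
      have := Real.exp_one_gt_d9
      have := Real.add_one_le_exp (1 / 4 : ℝ)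
      nlinarith
    have h3 := Real.add_one_le_exp (a / 2 - 9 / 4)
    rw [e]
    nlinarith
  have e : Real.exp a = Real.exp (a / 2) ^ 2 := by
    rw [← Real.exp_nat_mul]
    congr 1
    push_cast
    ring
  rw [e]
  nlinarith

/-- The energy of a damped oscillator controls the quadratic form appearing in
`hasCertificate_of_oscillator`. -/
theorem quadratic_form_le_of_energy_le {z q S x y : ℝ} (hz : 81 / 4 ≤ z) (hq : 0 ≤ q)
    (hzq : z * q = 1 / 2) {P Q R : ℝ} (hP : P ^ 2 = z + 2 + 2 * q) (hQ : Q = z + 1 + q)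
    (hR : R = 1 + q) (hS : 4 * z * (x ^ 2 + P * x * y + Q * y ^ 2) ≤ S) :
    P * (P * x ^ 2 + 2 * R * (y * x) + P * R * y ^ 2) ≤ S * R / 2 := by
  set E := x ^ 2 + P * x * y + Q * y ^ 2 with hE
  set V := Q - P ^ 2 / 4 with hV
  have hVpos : 0 < V := by rw [hV, hP, hQ]; linarith
  have hR0 : 0 < R := by rw [hR]; linarith
  have hy : V * y ^ 2 ≤ E := by nlinarith [sq_nonneg (x + P * y / 2)]
  have hx : V * x ^ 2 ≤ Q * E := by nlinarith [sq_nonneg (P * x / 2 + Q * y)]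
  have hE0 : 0 ≤ E := le_trans (by positivity) hy
  have hnum : (P ^ 2 + R) * Q + 2 * P ^ 2 * R ≤ 2 * z * V * R := by
    have hq' : q ≤ 1 / 40 := by nlinarith
    have h1 : z * z * q = z / 2 := by linear_combination z * hzq
    have h2 : z * q * q = q / 2 := by linear_combination q * hzq
    have h3 : q * q ≤ q := by nlinarith
    have h4 : 81 / 4 * z ≤ z * z := by nlinarith
    rw [hV, hP, hQ, hR]
    linarith
  have h1 : P * (P * x ^ 2 + 2 * R * (y * x) + P * R * y ^ 2)
      ≤ (P ^ 2 + R) * x ^ 2 + 2 * P ^ 2 * R * y ^ 2 := by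
    nlinarith [mul_nonneg hR0.le (sq_nonneg (x - P * y))]
  refine h1.trans (le_of_mul_le_mul_left ?_ hVpos)
  calc V * ((P ^ 2 + R) * x ^ 2 + 2 * P ^ 2 * R * y ^ 2)
      = (P ^ 2 + R) * (V * x ^ 2) + 2 * P ^ 2 * R * (V * y ^ 2) := by ring
    _ ≤ (P ^ 2 + R) * (Q * E) + 2 * P ^ 2 * R * E := by gcongr
    _ = ((P ^ 2 + R) * Q + 2 * P ^ 2 * R) * E := by ring
    _ ≤ 2 * z * V * R * E := by gcongr
    _ = V * R / 2 * (4 * z * E) := by ring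
    _ ≤ V * R / 2 * S := by gcongr
    _ = V * (S * R / 2) := by ring

/-- The solution of `σ'' + P σ' + Q σ = 0` with `σ 0 = 0` and `σ' 0 = 1`, in the underdamped
case, together with the value of its energy at `1`. -/
theorem exists_underdamped_solution {P Q : ℝ} (h : 0 < Q - P ^ 2 / 4) :
    ∃ σ σ' : ℝ → ℝ, (∀ t, HasDerivAt σ (σ' t) t) ∧
      (∀ t, HasDerivAt σ' (-P * σ' t - Q * σ t) t) ∧ σ 0 = 0 ∧ σ' 0 = 1 ∧
      σ' 1 ^ 2 + P * σ' 1 * σ 1 + Q * σ 1 ^ 2 = Real.exp (-P) := by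
  obtain ⟨W, hW, hQ⟩ : ∃ W : ℝ, 0 < W ∧ Q = W ^ 2 + P ^ 2 / 4 :=
    ⟨√(Q - P ^ 2 / 4), Real.sqrt_pos.2 h, by rw [Real.sq_sqrt h.le]; ring⟩
  have hexp (t : ℝ) : HasDerivAt (fun t => Real.exp (-(P / 2) * t))
      (Real.exp (-(P / 2) * t) * -(P / 2)) t := by
    simpa using ((hasDerivAt_id t).const_mul (-(P / 2))).exp
  have hsin (t : ℝ) : HasDerivAt (fun t => Real.sin (W * t)) (Real.cos (W * t) * W) t := by
    simpa using ((hasDerivAt_id t).const_mul W).sin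
  have hcos (t : ℝ) : HasDerivAt (fun t => Real.cos (W * t)) (-Real.sin (W * t) * W) t := by
    simpa using ((hasDerivAt_id t).const_mul W).cos
  refine ⟨fun t => Real.exp (-(P / 2) * t) * (Real.sin (W * t) / W),
    fun t => Real.exp (-(P / 2) * t) * (Real.cos (W * t) - P / (2 * W) * Real.sin (W * t)),
    fun t => ?_, fun t => ?_, by simp, by simp, ?_⟩
  · refine ((hexp t).mul ((hsin t).div_const W)).congr_deriv ?_
    field_simp
    ring
  · refine ((hexp t).mul ((hcos t).sub ((hsin t).const_mul (P / (2 * W))))).congr_deriv ?_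
    rw [hQ]
    simp only [Pi.sub_apply]
    field_simp
    ring
  · have e : Real.exp (-P) = Real.exp (-(P / 2) * 1) ^ 2 := by
      rw [← Real.exp_nat_mul]
      congr 1
      push_cast
      ring
    rw [e, hQ]
    beta_reduce
    generalize Real.exp (-(P / 2) * 1) = r
    have hs := Real.sin_sq_add_cos_sq (W * 1)
    generalize Real.sin (W * 1) = y at hs ⊢
    generalize Real.cos (W * 1) = x at hs ⊢
    field_simp
    linear_combination (16 * W ^ 2 * r ^ 2) * hs

theorem hasCertificate_of_ge
    (hu : ∀ t ∈ Icc (0 : ℝ) 1, HasDerivWithinAt u (v t) (Icc (0 : ℝ) 1) t)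
    (hv : ∀ t ∈ Icc (0 : ℝ) 1, HasDerivWithinAt v (w t) (Icc (0 : ℝ) 1) t)
    (h0 : v 0 = 0 ∨ u 0 = 0) {z : ℝ} (hz : 21 ≤ z) :
    HasCertificate (fun t => w t ^ 2 - z * v t ^ 2 + (z ^ 2 + 3 * z) * u t ^ 2) := by
  have hz0 : 0 < z := by linarith
  obtain ⟨q, hq⟩ : ∃ q, q = 1 / (2 * z) := ⟨_, rfl⟩
  have hq0 : 0 < q := by rw [hq]; positivity
  have hzq : z * q = 1 / 2 := by rw [hq]; field_simp
  have hq1 : q ≤ 1 := by nlinarith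
  have ha2 : √z ^ 2 = z := Real.sq_sqrt hz0.le
  have ha : 9 / 2 ≤ √z := Real.le_sqrt_of_sq_le (by norm_num; linarith)
  obtain ⟨P, hP⟩ : ∃ P, P = √z + 1 / √z := ⟨_, rfl⟩
  have hP0 : 0 < P := by rw [hP]; positivity
  have hP2 : P ^ 2 = z + 2 + 2 * q := by
    rw [hP, hq, add_sq, div_pow, ha2]
    field_simp
  obtain ⟨Q, hQ⟩ : ∃ Q, Q = z + 1 + q := ⟨_, rfl⟩
  obtain ⟨R, hR⟩ : ∃ R, R = 1 + q := ⟨_, rfl⟩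
  have hQ0 : 0 < Q := by linarith
  have hR0 : 0 < R := by linarith
  have hPQ : P ^ 2 - 2 * Q = -z := by linarith
  have hPQR : Q = P ^ 2 - R := by linarith
  have hQz : Q ^ 2 ≤ z ^ 2 + 3 * z := by rw [hQ]; nlinarith
  have hexp : 4 * z * Real.exp (-P) ≤ 1 := by
    have h1 : 4 * z ≤ Real.exp P := by
      rw [← ha2]
      refine (four_mul_sq_le_exp ha).trans (Real.exp_le_exp.2 ?_)
      rw [hP]
      have : 0 ≤ 1 / √z := by positivity
      linarith
    rw [Real.exp_neg, ← div_eq_mul_inv]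
    exact (div_le_one (Real.exp_pos P)).2 h1
  obtain ⟨σ, σ', hσ, hσ', hσ0, hσ'0, hE⟩ :=
    exists_underdamped_solution (P := P) (Q := Q) (by linarith)
  rcases h0 with h0 | h0
  · refine hasCertificate_of_oscillator hu hv hP0 hQ0 hR0 (mul_pos hP0 hQ0) hPQ hPQR hQz hσ hσ'
      ?_ ?_ ?_
    · rw [h0, hσ0, hσ'0]
      ring
    · rw [hσ0, hσ'0]
      field_simp
      ring
    · have h := quadratic_form_le_of_energy_le (by linarith) hq0.le hzq hP2 hQ hR
        (hE.symm ▸ hexp)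
      nlinarith [mul_le_mul_of_nonneg_left h hQ0.le]
  · refine hasCertificate_of_oscillator (η := σ') (η' := fun t => -P * σ' t - Q * σ t)
      hu hv hP0 hQ0 hR0 hP0 hPQ hPQR hQz hσ'
      (fun t => (((hσ' t).const_mul (-P)).sub ((hσ t).const_mul Q))) ?_ ?_ ?_
    · simp only [h0, hσ0, hσ'0]
      ring
    · simp only [hσ0, hσ'0]
      field_simp
      ring
    · have hE' : 4 * z * ((-P * σ' 1 - Q * σ 1) ^ 2 + P * (-P * σ' 1 - Q * σ 1) * σ' 1
          + Q * σ' 1 ^ 2) ≤ Q := by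
        calc _ = Q * (4 * z * (σ' 1 ^ 2 + P * σ' 1 * σ 1 + Q * σ 1 ^ 2)) := by ring
          _ ≤ Q * 1 := by rw [hE]; gcongr
          _ = Q := mul_one Q
      exact quadratic_form_le_of_energy_le (by linarith) hq0.le hzq hP2 hQ hR hE'

end Half

/-- Derivative of the even (`δ = 1`) and odd (`δ = -1`) parts of `g` about `c`, rescaled to
`[0, 1]`. -/
theorem hasDerivWithinAt_comp_add_comp_sub {g g' : ℝ → ℝ} {c : ℝ} (hc : 0 < c)
    (hg : ∀ t ∈ Icc (0 : ℝ) (2 * c), HasDerivWithinAt g (g' t) (Icc (0 : ℝ) (2 * c)) t)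
    (δ : ℝ) {t : ℝ} (ht : t ∈ Icc (0 : ℝ) 1) :
    HasDerivWithinAt (fun t => g (c + c * t) + δ * g (c - c * t))
      (c * (g' (c + c * t) - δ * g' (c - c * t))) (Icc (0 : ℝ) 1) t := by
  have hp : MapsTo (fun t => c + c * t) (Icc (0 : ℝ) 1) (Icc (0 : ℝ) (2 * c)) :=
    fun s hs => ⟨by nlinarith [hs.1], by nlinarith [hs.2]⟩
  have hm : MapsTo (fun t => c - c * t) (Icc (0 : ℝ) 1) (Icc (0 : ℝ) (2 * c)) :=
    fun s hs => ⟨by nlinarith [hs.2], by nlinarith [hs.1]⟩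
  have dp := (((hasDerivAt_id t).const_mul c).const_add c).hasDerivWithinAt (s := Icc (0 : ℝ) 1)
  have dm := (((hasDerivAt_id t).const_mul c).const_sub c).hasDerivWithinAt (s := Icc (0 : ℝ) 1)
  exact (((hg _ (hp ht)).comp t dp hp).add
    (((hg _ (hm ht)).comp t dm hm).const_mul δ)).congr_deriv (by ring)

theorem intervalIntegrable_comp_add_and_comp_sub {g : ℝ → ℝ} {c : ℝ} (hc : 0 < c)
    (hg : IntervalIntegrable g volume 0 (2 * c)) :
    IntervalIntegrable (fun t => g (c + c * t)) volume 0 1 ∧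
      IntervalIntegrable (fun t => g (c - c * t)) volume 0 1 := by
  have hmem : c ∈ uIcc 0 (2 * c) := mem_uIcc_of_le hc.le (by linarith)
  have h1 : IntervalIntegrable g volume c (2 * c) :=
    hg.mono_set (uIcc_subset_uIcc hmem right_mem_uIcc)
  have h2 : IntervalIntegrable g volume 0 c := hg.mono_set (uIcc_subset_uIcc left_mem_uIcc hmem)
  have h3 := (h1.comp_add_left c).comp_mul_left (c := c)
  have h4 := (h2.comp_sub_left c).symm.comp_mul_left (c := c)
  have e : (2 * c - c) / c = 1 := by field_simp; ring
  rw [sub_self, zero_div, e] at h3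
  rw [sub_self, sub_zero, zero_div, div_self hc.ne'] at h4
  exact ⟨h3, h4⟩

theorem integral_comp_add_add_comp_sub {g : ℝ → ℝ} {c : ℝ} (hc : 0 < c)
    (hg : IntervalIntegrable g volume 0 (2 * c)) :
    c * ∫ t in (0 : ℝ)..1, (g (c + c * t) + g (c - c * t)) = ∫ t in (0 : ℝ)..2 * c, g t := by
  have hmem : c ∈ uIcc 0 (2 * c) := mem_uIcc_of_le hc.le (by linarith)
  obtain ⟨h1, h2⟩ := intervalIntegrable_comp_add_and_comp_sub hc hg
  rw [intervalIntegral.integral_add h1 h2, mul_add,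
    intervalIntegral.mul_integral_comp_add_mul, intervalIntegral.mul_integral_comp_sub_mul,
    add_comm]
  simp only [mul_zero, mul_one, sub_self, sub_zero, add_zero]
  rw [← two_mul]
  exact intervalIntegral.integral_add_adjacent_intervals
    (hg.mono_set (uIcc_subset_uIcc left_mem_uIcc hmem))
    (hg.mono_set (uIcc_subset_uIcc hmem right_mem_uIcc))

/-- **Halperin–Pitt inequality.** If `f` is (locally absolutely) continuously differentiable
on `[0, A]` with derivative `f'`, and `f'` is differentiable with derivative `f''` which is
square integrable on `[0, A]`, then for every `ε > 0`, with `K(ε) = 1/ε + 12/A²`,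
`∫₀^A (f')² ≤ K(ε) ∫₀^A f² + ε ∫₀^A (f'')²`. -/
theorem halperin_pitt
    (A : ℝ) (hA : 0 < A) (f f' f'' : ℝ → ℝ)
    (hf : ∀ t ∈ Icc (0:ℝ) A, HasDerivWithinAt f (f' t) (Icc (0:ℝ) A) t)
    (hf' : ∀ t ∈ Icc (0:ℝ) A, HasDerivWithinAt f' (f'' t) (Icc (0:ℝ) A) t)
    (hf'' : IntervalIntegrable (fun t => (f'' t) ^ 2) volume 0 A)
    (ε : ℝ) (hε : 0 < ε) :
    ∫ t in (0:ℝ)..A, (f' t) ^ 2 ≤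
      (1 / ε + 12 / A ^ 2) * (∫ t in (0:ℝ)..A, (f t) ^ 2)
        + ε * ∫ t in (0:ℝ)..A, (f'' t) ^ 2 := by
  obtain ⟨c, rfl⟩ : ∃ c, A = 2 * c := ⟨A / 2, by ring⟩
  have hc : 0 < c := by linarith
  obtain ⟨z, hz⟩ : ∃ z, z = c ^ 2 / ε := ⟨_, rfl⟩
  have hz0 : 0 < z := by rw [hz]; positivity
  have hU (δ : ℝ) (t : ℝ) (ht : t ∈ Icc (0 : ℝ) 1) :=
    hasDerivWithinAt_comp_add_comp_sub hc hf δ ht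
  have hV (δ : ℝ) (t : ℝ) (ht : t ∈ Icc (0 : ℝ) 1) :
      HasDerivWithinAt (fun t => c * (f' (c + c * t) - δ * f' (c - c * t)))
        (c ^ 2 * (f'' (c + c * t) + δ * f'' (c - c * t))) (Icc (0 : ℝ) 1) t := by
    have h := (hasDerivWithinAt_comp_add_comp_sub hc hf' (-δ) ht).const_mul c
    simp only [neg_mul, sub_neg_eq_add, ← sub_eq_add_neg] at h
    exact h.congr_deriv (by ring)
  have heven := (le_total z 21).elim
    (hasCertificate_even_of_le (hU 1) (hV 1) (by simp) hz0)
    (hasCertificate_of_ge (hU 1) (hV 1) (.inl (by simp)))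
  have hodd := (le_total z 21).elim
    (hasCertificate_odd_of_le (hU (-1)) (hV (-1)) (by simp) hz0)
    (hasCertificate_of_ge (hU (-1)) (hV (-1)) (.inr (by simp)))
  have hF : IntervalIntegrable (fun t => f t ^ 2) volume 0 (2 * c) := by
    exact (ContinuousOn.pow (fun t ht => (hf t ht).continuousWithinAt)
      2).intervalIntegrable_of_Icc hA.le
  have hD : IntervalIntegrable (fun t => f' t ^ 2) volume 0 (2 * c) := by
    exact (ContinuousOn.pow (fun t ht => (hf' t ht).continuousWithinAt)
      2).intervalIntegrable_of_Icc hA.le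
  set g : ℝ → ℝ := fun t => c ^ 4 * f'' t ^ 2 - z * c ^ 2 * f' t ^ 2 + (z ^ 2 + 3 * z) * f t ^ 2
    with hgdef
  have hg : IntervalIntegrable g volume 0 (2 * c) :=
    ((hf''.const_mul _).sub (hD.const_mul _)).add (hF.const_mul _)
  have hsum : HasCertificate (fun t => 2 * (g (c + c * t) + g (c - c * t))) := by
    convert heven.add hodd using 2 with t
    simp only [hgdef]
    ring
  obtain ⟨i1, i2⟩ := intervalIntegrable_comp_add_and_comp_sub hc hg
  have hnn := hsum.integral_nonneg ((i1.add i2).const_mul 2)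
  rw [intervalIntegral.integral_const_mul] at hnn
  have hg0 : 0 ≤ ∫ t in (0 : ℝ)..2 * c, g t := by
    rw [← integral_comp_add_add_comp_sub hc hg]
    exact mul_nonneg hc.le (by linarith)
  rw [hgdef, intervalIntegral.integral_add ((hf''.const_mul _).sub (hD.const_mul _))
    (hF.const_mul _), intervalIntegral.integral_sub (hf''.const_mul _) (hD.const_mul _)] at hg0
  simp only [intervalIntegral.integral_const_mul] at hg0
  refine le_of_mul_le_mul_left ?_ (show 0 < z * c ^ 2 by positivity)
  generalize (∫ t in (0 : ℝ)..2 * c, f t ^ 2) = F at hg0 ⊢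
  generalize (∫ t in (0 : ℝ)..2 * c, f' t ^ 2) = D at hg0 ⊢
  generalize (∫ t in (0 : ℝ)..2 * c, f'' t ^ 2) = G at hg0 ⊢
  have e : z * c ^ 2 * ((1 / ε + 12 / (2 * c) ^ 2) * F + ε * G)
      = c ^ 4 * G + (z ^ 2 + 3 * z) * F := by
    rw [hz]
    field_simp
    ring
  rw [e]
  linarith
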